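/- arXiv:1705.00770 — 2 statements merged into one kernel-verified Lean document; each statement's English description precedes it below -/
import Mathlib

section
/- Let q = p^e (p prime), 0 ≤ k < e, and λ ∈ F_q^*. If C is a λ-constacyclic code of length n over F_q, then its Galois dual C^{⊥_k} is a λ^{−p^{e-k}}-constacyclic code of length n over F_q. -/
open Finset

/-- The `k`-Galois dual (as a set): all vectors `x` with `∑ i, c i * (x i)^pk = 0`
for every `c ∈ C`, where `pk = p^k`. -/
def galoisDualSet {F : Type*} [Field F] {ι : Type*} [Fintype ι] (pk : ℕ)
    (C : Set (ι → F)) : Set (ι → F) :=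
  {x | ∀ c ∈ C, ∑ i, c i * x i ^ pk = 0}

/-- The `λ`-constacyclic shift `(c₀, c₁, …, c_{n-1}) ↦ (λ c_{n-1}, c₀, …, c_{n-2})`. -/
def constaShift {F : Type*} [Field F] {n : ℕ} (lam : F) (c : Fin n → F) : Fin n → F :=
  fun i =>
    if (i : ℕ) = 0 then lam * c ⟨n - 1, by have := i.isLt; omega⟩
    else c ⟨(i : ℕ) - 1, by have := i.isLt; omega⟩

/-- A linear code is `λ`-constacyclic if it is closed under the `λ`-constacyclic shift. -/
def IsConstacyclic {F : Type*} [Field F] {n : ℕ} (lam : F)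
    (C : Submodule F (Fin n → F)) : Prop :=
  ∀ c ∈ C, constaShift lam c ∈ C

/-- On `Fin (m + 1)`, the first coordinate of the constacyclic shift. -/
theorem constaShift_zero {F : Type*} [Field F] {m : ℕ} (lam : F) (c : Fin (m + 1) → F) :
    constaShift lam c 0 = lam * c (Fin.last m) := by
  simp [constaShift, Fin.last]

/-- On `Fin (m + 1)`, the remaining coordinates of the constacyclic shift. -/
theorem constaShift_succ {F : Type*} [Field F] {m : ℕ} (lam : F) (c : Fin (m + 1) → F)
    (i : Fin m) : constaShift lam c i.succ = c i.castSucc := by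
  simp [constaShift, Fin.castSucc, Fin.castAdd, Fin.castLE]

theorem constaShift_injective {F : Type*} [Field F] {n : ℕ} {lam : F} (hlam : lam ≠ 0) :
    Function.Injective (constaShift lam : (Fin n → F) → Fin n → F) := by
  intro c d h
  cases n with
  | zero => exact Subsingleton.elim c d
  | succ m =>
    funext i
    induction i using Fin.lastCases with
    | last =>
      have h_zero := congrFun h 0
      rw [constaShift_zero, constaShift_zero] at h_zero
      exact mul_left_cancel₀ hlam h_zero
    | cast i =>
      have h_succ := congrFun h i.succ
      rwa [constaShift_succ, constaShift_succ] at h_succ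

/-- Over a finite field, every codeword of a constacyclic code is the shift of a codeword. -/
theorem IsConstacyclic.exists_constaShift_eq {F : Type*} [Field F] [Finite F] {n : ℕ} {lam : F}
    (hlam : lam ≠ 0) {C : Submodule F (Fin n → F)} (hC : IsConstacyclic lam C)
    {c : Fin n → F} (hc : c ∈ C) : ∃ d ∈ C, constaShift lam d = c := by
  have h_inj : Function.Injective (fun d : C => (⟨constaShift lam d, hC d d.2⟩ : C)) :=
    fun a b h => Subtype.ext (constaShift_injective hlam (congrArg Subtype.val h))
  obtain ⟨d, hd⟩ := Finite.surjective_of_injective h_inj ⟨c, hc⟩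
  exact ⟨d, d.2, congrArg Subtype.val hd⟩

/-- Shifting both arguments by compatible constants preserves the Galois inner product. -/
theorem sum_constaShift_mul_pow {F : Type*} [Field F] {n r : ℕ} {lam mu : F}
    (h : lam * mu ^ r = 1) (c x : Fin n → F) :
    ∑ i, constaShift lam c i * constaShift mu x i ^ r = ∑ i, c i * x i ^ r := by
  cases n with
  | zero => simp
  | succ m =>
    rw [Fin.sum_univ_succ, Fin.sum_univ_castSucc]
    simp only [constaShift_zero, constaShift_succ]
    rw [add_comm, mul_pow, mul_mul_mul_comm, h, one_mul]

/-- If `C` is a `λ`-constacyclic code of length `n` over `F_q` (`q = p^e`,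
`0 ≤ k < e`), then its Galois dual `C^{⊥_k}` is a `λ^{-p^{e-k}}`-constacyclic code. -/
theorem stmt5 {p e k n : ℕ} (hp : p.Prime) (hk : k < e)
    {F : Type*} [Field F] [Fintype F] (hcard : Fintype.card F = p ^ e)
    (lam : F) (hlam : lam ≠ 0)
    (C : Submodule F (Fin n → F)) (hC : IsConstacyclic lam C) :
    ∀ x ∈ galoisDualSet (p ^ k) (C : Set (Fin n → F)),
      constaShift ((lam ^ p ^ (e - k))⁻¹) x ∈ galoisDualSet (p ^ k) (C : Set (Fin n → F)) := by
  intro x hx c hc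
  obtain ⟨d, hd, rfl⟩ := hC.exists_constaShift_eq hlam hc
  have h_pow : lam * ((lam ^ p ^ (e - k))⁻¹) ^ p ^ k = 1 := by
    rw [inv_pow, ← pow_mul, ← pow_add, Nat.sub_add_cancel hk.le, ← hcard, FiniteField.pow_card,
      mul_inv_cancel₀ hlam]
  rw [sum_constaShift_mul_pow h_pow]
  exact hx d hd
end

section
/- Let q = p^e (p prime), 0 ≤ k < e, λ ∈ F_q^* with order r and λ^{1+p^{e-k}} = 1, and n coprime to q. Then every λ-constacyclic code C_P of length n over F_q (for every defining set P ⊆ 1 + rZ_{rn} that is a union of q-cyclotomic cosets) is a Galois LCD code with respect to the k-Galois inner product if and only if there exists an integer j such that p^{ej−k} ≡ −1 (mod rn). -/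
open Finset Polynomial

/-- The subset `1 + rZ_{rn} = {1 + rt : t = 0, 1, …, n-1}` of `Z_{rn}`. -/
def oneCoset (r n : ℕ) : Set (ZMod (r * n)) :=
  {x | ∃ t : ℕ, t < n ∧ x = 1 + (r : ZMod (r * n)) * (t : ZMod (r * n))}

/-- The constacyclic code of length `n` over `F` whose defining set is `P`: all vectors `c`
such that `θ^i` is a root of `c₀ + c₁X + ⋯ + c_{n-1}X^{n-1}` for every `i ∈ P`. -/
noncomputable def codeOfDefSet (F : Type*) {E : Type*} [Field F] [Field E] [Algebra F E]
    (n : ℕ) {N : ℕ} (θ : E) (P : Set (ZMod N)) : Set (Fin n → F) :=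
  {c | ∀ i ∈ P, Polynomial.aeval (θ ^ i.val)
      (∑ j : Fin n, Polynomial.C (c j) * X ^ (j : ℕ)) = 0}

theorem FiniteField.mem_range_algebraMap_of_pow_card_eq {F E : Type*} [Field F] [Fintype F]
    [Field E] [Algebra F E] {y : E} (hy : y ^ Fintype.card F = y) :
    ∃ a : F, algebraMap F E a = y := by
  classical
  have h1 : 1 < Fintype.card F := Fintype.one_lt_card
  have hsub : Finset.univ.map ⟨algebraMap F E, (algebraMap F E).injective⟩ ⊆
      (X ^ Fintype.card F - X : E[X]).roots.toFinset := by
    intro z hz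
    obtain ⟨a, -, rfl⟩ := Finset.mem_map.1 hz
    rw [Multiset.mem_toFinset, mem_roots (FiniteField.X_pow_card_sub_X_ne_zero E h1)]
    simp [← map_pow, FiniteField.pow_card]
  have heq := Finset.eq_of_subset_of_card_le hsub <| by
    rw [Finset.card_map, Finset.card_univ]
    exact (Multiset.toFinset_card_le _).trans ((card_roots' _).trans
      (FiniteField.X_pow_card_sub_X_natDegree_eq E h1).le)
  have hmem : y ∈ (X ^ Fintype.card F - X : E[X]).roots.toFinset := by
    rw [Multiset.mem_toFinset, mem_roots (FiniteField.X_pow_card_sub_X_ne_zero E h1)]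
    simp [hy]
  rw [← heq] at hmem
  obtain ⟨a, -, ha⟩ := Finset.mem_map.1 hmem
  exact ⟨a, ha⟩

theorem geom_sum_eq_ite_of_pow_eq_one {E : Type*} [Field E] [DecidableEq E] {n : ℕ} {z : E}
    (hz : z ^ n = 1) : ∑ j : Fin n, z ^ (j : ℕ) = if z = 1 then (n : E) else 0 := by
  rw [Fin.sum_univ_eq_sum_range (fun j => z ^ j) n]
  split_ifs with h
  · simp [h]
  · rw [geom_sum_eq h, hz]; simp

theorem sum_inv_mul_pow_eq_ite {E : Type*} [Field E] [DecidableEq E] {n : ℕ} {z w Λ : E}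
    (hΛ : Λ ≠ 0) (hn : n ≠ 0) (hz : z ^ n = Λ) (hw : w ^ n = Λ) :
    ∑ j : Fin n, (z⁻¹ * w) ^ (j : ℕ) = if z = w then (n : E) else 0 := by
  have hz0 : z ≠ 0 := by rintro rfl; exact hΛ (by rw [← hz, zero_pow hn])
  rw [geom_sum_eq_ite_of_pow_eq_one (by rw [mul_pow, inv_pow, hz, hw, inv_mul_cancel₀ hΛ])]
  simp only [inv_mul_eq_one₀ hz0]

/-- Frobenius-stable power sums have coordinates in the base field. -/
theorem exists_algebraMap_eq_sum_inv_pow {F E : Type*} [Field F] [Fintype F] [Field E]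
    [Algebra F E] (A : Finset E) (hA : ∀ z ∈ A, z ^ Fintype.card F ∈ A) (t : ℕ) :
    ∃ a : F, algebraMap F E a = ∑ z ∈ A, z⁻¹ ^ t := by
  classical
  apply FiniteField.mem_range_algebraMap_of_pow_card_eq
  obtain ⟨p, hchar⟩ := CharP.exists F
  obtain ⟨m, hp, hm⟩ := FiniteField.card F p
  have := Fact.mk hp
  have : CharP E p := charP_of_injective_algebraMap (algebraMap F E).injective p
  have hinj : Function.Injective (fun z : E => z ^ Fintype.card F) := by
    rw [hm]; exact iterateFrobenius_inj E p m
  rw [hm, sum_pow_char_pow, ← hm]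
  have himg : A.image (fun z : E => z ^ Fintype.card F) = A := by
    apply Finset.eq_of_subset_of_card_le
    · intro z hz
      obtain ⟨w, hw, rfl⟩ := Finset.mem_image.1 hz
      exact hA w hw
    · rw [Finset.card_image_of_injective _ hinj]
  conv_rhs => rw [← himg]
  rw [Finset.sum_image hinj.injOn]
  refine Finset.sum_congr rfl fun z _ => ?_
  rw [← inv_pow, ← pow_mul, ← pow_mul, mul_comm]

theorem sum_sum_inv_pow_mul_pow {E : Type*} [Field E] [DecidableEq E] {n : ℕ} {w Λ : E}
    (hΛ : Λ ≠ 0) (hn : n ≠ 0) (A : Finset E) (hA : ∀ z ∈ A, z ^ n = Λ) (hw : w ^ n = Λ) (t : ℕ) :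
    ∑ j : Fin n, (∑ z ∈ A, z⁻¹ ^ (t + (j : ℕ))) * w ^ (j : ℕ) =
      if w ∈ A then n * w⁻¹ ^ t else 0 := by
  simp_rw [Finset.sum_mul]
  rw [Finset.sum_comm]
  have : ∀ z ∈ A, ∑ j : Fin n, z⁻¹ ^ (t + (j : ℕ)) * w ^ (j : ℕ) =
      if z = w then n * w⁻¹ ^ t else 0 := by
    intro z hz
    simp_rw [pow_add, mul_assoc, ← mul_pow]
    rw [← Finset.mul_sum, sum_inv_mul_pow_eq_ite hΛ hn (hA z hz) hw]
    split_ifs with h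
    · rw [h, mul_comm]
    · simp
  rw [Finset.sum_congr rfl this, Finset.sum_ite_eq' A w]

theorem mem_oneCoset_iff {r n : ℕ} [NeZero (r * n)] {x : ZMod (r * n)} :
    x ∈ oneCoset r n ↔ ∃ t : ZMod (r * n), x = 1 + r * t := by
  constructor
  · rintro ⟨t, -, h⟩
    exact ⟨t, h⟩
  · rintro ⟨t, rfl⟩
    have hn : 0 < n := Nat.pos_of_ne_zero fun h => NeZero.ne (r * n) (by simp [h])
    refine ⟨t.val % n, Nat.mod_lt _ hn, ?_⟩
    have h0 : (r : ZMod (r * n)) * n = 0 := by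
      rw [← Nat.cast_mul, ZMod.natCast_self]
    have h1 : t = ((t.val % n + n * (t.val / n) : ℕ) : ZMod (r * n)) := by
      rw [Nat.mod_add_div]; simp
    conv_lhs => rw [h1]
    push_cast
    rw [mul_add, ← mul_assoc, h0, zero_mul, add_zero]

theorem mem_codeOfDefSet_iff {F E : Type*} [Field F] [Field E] [Algebra F E] {n N : ℕ} {θ : E}
    {P : Set (ZMod N)} {c : Fin n → F} :
    c ∈ codeOfDefSet F n θ P ↔
      ∀ i ∈ P, ∑ j, algebraMap F E (c j) * (θ ^ i.val) ^ (j : ℕ) = 0 := by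
  simp [codeOfDefSet]

theorem pow_val_natCast {M : Type*} [Monoid M] {θ : M} {N : ℕ} (hN : orderOf θ = N)
    (a : ℕ) : θ ^ (a : ZMod N).val = θ ^ a := by
  subst hN
  rw [ZMod.val_natCast, pow_mod_orderOf]

theorem pow_val_natCast_mul {M : Type*} [Monoid M] {θ : M} {N : ℕ} (hN : orderOf θ = N)
    (a : ℕ) (i : ZMod N) : θ ^ ((a : ZMod N) * i).val = (θ ^ i.val) ^ a := by
  subst hN
  rw [← pow_mul, ← pow_mod_orderOf θ (i.val * a), ZMod.val_mul, ZMod.val_natCast,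
    Nat.mod_mul_mod, mul_comm]

theorem pow_val_neg {E : Type*} [DivisionRing E] {θ : E} {N : ℕ} [NeZero N]
    (hN : orderOf θ = N) (i : ZMod N) : θ ^ (-i).val = (θ ^ i.val)⁻¹ := by
  apply eq_inv_of_mul_eq_one_left
  subst hN
  rw [← pow_add, ← pow_mod_orderOf, ← ZMod.val_add, neg_add_cancel, ZMod.val_zero, pow_zero]

theorem injective_pow_val {M : Type*} [Monoid M] {θ : M} {N : ℕ} [NeZero N]
    (hN : orderOf θ = N) : Function.Injective (fun i : ZMod N => θ ^ i.val) := by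
  intro i j h
  apply ZMod.val_injective
  exact pow_injOn_Iio_orderOf (by rw [hN]; exact ZMod.val_lt i) (by rw [hN]; exact ZMod.val_lt j) h

theorem pow_val_pow_of_mem_oneCoset {M : Type*} [Monoid M] {θ : M} {r n : ℕ}
    (hθ : orderOf θ = r * n) {i : ZMod (r * n)} (hi : i ∈ oneCoset r n) :
    (θ ^ i.val) ^ n = θ ^ n := by
  obtain ⟨t, -, rfl⟩ := hi
  have h : (1 + r * t : ZMod (r * n)) = ((1 + r * t : ℕ) : ZMod (r * n)) := by push_cast; rfl
  rw [h, pow_val_natCast hθ, ← pow_mul, show (1 + r * t) * n = n + r * n * t by ring, pow_add,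
    pow_mul θ (r * n), ← hθ, pow_orderOf_eq_one, one_pow, mul_one]

theorem natCast_mul_mem_oneCoset {r n a : ℕ} [NeZero (r * n)] (ha : a ≡ 1 [MOD r])
    {i : ZMod (r * n)} (hi : i ∈ oneCoset r n) : (a : ZMod (r * n)) * i ∈ oneCoset r n := by
  rw [mem_oneCoset_iff] at hi ⊢
  obtain ⟨t, rfl⟩ := hi
  obtain ⟨c, hc⟩ := (Nat.modEq_iff_dvd.1 ha.symm)
  have h : (a : ZMod (r * n)) = 1 + r * c := by
    have := congrArg (Int.cast : ℤ → ZMod (r * n)) hc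
    push_cast at this
    linear_combination this
  exact ⟨c + t + r * c * t, by rw [h]; ring⟩

theorem neg_natCast_mul_mem_oneCoset {r n a : ℕ} [NeZero (r * n)] (ha : r ∣ 1 + a)
    {i : ZMod (r * n)} (hi : i ∈ oneCoset r n) : -((a : ZMod (r * n)) * i) ∈ oneCoset r n := by
  rw [mem_oneCoset_iff] at hi ⊢
  obtain ⟨t, rfl⟩ := hi
  obtain ⟨c, hc⟩ := ha
  have h : (a : ZMod (r * n)) = r * c - 1 := by
    have := congrArg (Nat.cast : ℕ → ZMod (r * n)) hc
    push_cast at this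
    linear_combination this
  exact ⟨t - c - r * c * t, by rw [h]; ring⟩

theorem image_mul_eq_of_subset {R : Type*} [CommRing R] [Finite R] {u : R} (hu : IsUnit u)
    {S : Set R} (hS : ∀ s ∈ S, u * s ∈ S) : (fun x => u * x) '' S = S := by
  apply Set.eq_of_subset_of_ncard_le (Set.image_subset_iff.2 hS)
  rw [Set.ncard_image_of_injective _ hu.mul_right_injective]

/-- A vector over `F` whose transform vanishes on all of `1 + rZ_{rn}` is zero. -/
theorem eq_zero_of_forall_mem_oneCoset {F E : Type*} [Field F] [Field E] [Algebra F E] {r n : ℕ}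
    [NeZero (r * n)] {θ : E} (hθ : orderOf θ = r * n) {x : Fin n → F}
    (hx : ∀ i ∈ oneCoset r n, ∑ j, algebraMap F E (x j) * (θ ^ i.val) ^ (j : ℕ) = 0) :
    x = 0 := by
  have hr : 0 < r := Nat.pos_of_ne_zero fun h => NeZero.ne (r * n) (by simp [h])
  have hv : (fun j => algebraMap F E (x j)) = 0 := by
    refine Matrix.eq_zero_of_forall_index_sum_mul_pow_eq_zero
      (f := fun t : Fin n => θ ^ ((1 + r * t : ℕ) : ZMod (r * n)).val) ?_ ?_
    · intro s t h
      have h' := injective_pow_val hθ h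
      rw [ZMod.natCast_eq_natCast_iff] at h'
      have h2 := Nat.ModEq.mul_left_cancel' hr.ne' (Nat.ModEq.add_left_cancel' 1 h')
      exact Fin.ext (h2.eq_of_lt_of_lt s.2 t.2)
    · intro t
      exact hx _ ⟨t, t.2, by push_cast; rfl⟩
  funext j
  exact (algebraMap F E).injective (by simpa using congrFun hv j)

/-- The finite set of powers `θ^i`, `i ∈ Q`, for a Frobenius-stable `Q ⊆ 1 + rZ_{rn}`. -/
theorem exists_finset_pow_val {F E : Type*} [Fintype F] [Field E] {r n : ℕ} [NeZero (r * n)]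
    {θ : E} (hθ : orderOf θ = r * n) {Q : Set (ZMod (r * n))} (hQ' : Q ⊆ oneCoset r n)
    (hQ : ∀ i ∈ Q, (Fintype.card F : ZMod (r * n)) * i ∈ Q) :
    ∃ A : Finset E, (∀ i : ZMod (r * n), θ ^ i.val ∈ A ↔ i ∈ Q) ∧
      (∀ z ∈ A, ∃ i ∈ Q, θ ^ i.val = z) ∧ (∀ z ∈ A, z ^ n = θ ^ n) ∧
      ∀ z ∈ A, z ^ Fintype.card F ∈ A := by
  classical
  have hmem : ∀ z, z ∈ (Q.toFinite.toFinset).image (fun i => θ ^ i.val) ↔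
      ∃ i ∈ Q, θ ^ i.val = z := by simp
  refine ⟨(Q.toFinite.toFinset).image fun i => θ ^ i.val, fun i => ?_, fun z => (hmem z).1,
    fun z hz => ?_, fun z hz => ?_⟩
  · rw [hmem]
    exact (injective_pow_val hθ).mem_set_image
  · obtain ⟨i, hi, rfl⟩ := (hmem z).1 hz
    exact pow_val_pow_of_mem_oneCoset hθ (hQ' hi)
  · obtain ⟨i, hi, rfl⟩ := (hmem z).1 hz
    exact (hmem _).2 ⟨_, hQ i hi, pow_val_natCast_mul hθ _ i⟩

/-- If `y` is orthogonal to every code vector then its transform vanishes at the inverses of the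
non-roots of the code. -/
theorem sum_mul_inv_pow_eq_zero_of_orthogonal {F E : Type*} [Field F] [Fintype F] [Field E]
    [Algebra F E] {r n : ℕ} [NeZero (r * n)] {θ : E} (hθ : orderOf θ = r * n) (hnE : (n : E) ≠ 0)
    {P : Set (ZMod (r * n))}
    (hP : ∀ i ∈ oneCoset r n \ P, (Fintype.card F : ZMod (r * n)) * i ∈ oneCoset r n \ P)
    (hP' : P ⊆ oneCoset r n) {y : Fin n → F}
    (hy : ∀ c ∈ codeOfDefSet F n θ P, ∑ j, c j * y j = 0)
    {b : ZMod (r * n)} (hb : b ∈ oneCoset r n \ P) :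
    ∑ j, algebraMap F E (y j) * (θ ^ b.val)⁻¹ ^ (j : ℕ) = 0 := by
  classical
  have hn : n ≠ 0 := by rintro rfl; simp at hnE
  have hΛ : θ ^ n ≠ 0 := pow_ne_zero _ <| by
    rintro rfl
    exact NeZero.ne (r * n) (by rw [← hθ]; simp)
  obtain ⟨A, hAmem, -, hAn, hAq⟩ :=
    exists_finset_pow_val (F := F) hθ Set.sdiff_subset hP
  choose a ha using exists_algebraMap_eq_sum_inv_pow (F := F) A hAq
  have hcode : ∀ t, (fun j : Fin n => a (t + j)) ∈ codeOfDefSet F n θ P := by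
    intro t
    rw [mem_codeOfDefSet_iff]
    intro s hs
    simp_rw [ha]
    rw [sum_sum_inv_pow_mul_pow hΛ hn A hAn (pow_val_pow_of_mem_oneCoset hθ (hP' hs)),
      if_neg]
    rw [hAmem]
    exact fun h => h.2 hs
  set Y : E → E := fun z => ∑ j, algebraMap F E (y j) * z⁻¹ ^ (j : ℕ) with hY
  have hsum : ∀ t : ℕ, ∑ z ∈ A, z⁻¹ ^ t * Y z = 0 := by
    intro t
    have h := congrArg (algebraMap F E) (hy _ (hcode t))
    simp only [map_sum, map_mul, ha, map_zero] at h
    rw [← h]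
    simp_rw [hY, Finset.mul_sum, Finset.sum_mul]
    rw [Finset.sum_comm]
    refine Finset.sum_congr rfl fun j _ => Finset.sum_congr rfl fun z _ => ?_
    rw [pow_add]; ring
  set w := θ ^ b.val with hw
  have hwA : w ∈ A := (hAmem b).2 hb
  have key : ∑ t : Fin n, (∑ z ∈ A, z⁻¹ ^ (t : ℕ) * Y z) * w ^ (t : ℕ) = n * Y w := by
    simp_rw [Finset.sum_mul]
    rw [Finset.sum_comm]
    have : ∀ z ∈ A, ∑ t : Fin n, z⁻¹ ^ (t : ℕ) * Y z * w ^ (t : ℕ) =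
        if z = w then n * Y w else 0 := by
      intro z hz
      have h : ∀ t : Fin n, z⁻¹ ^ (t : ℕ) * Y z * w ^ (t : ℕ) = (z⁻¹ * w) ^ (t : ℕ) * Y z := by
        intro t; rw [mul_pow]; ring
      simp_rw [h]
      rw [← Finset.sum_mul, sum_inv_mul_pow_eq_ite hΛ hn (hAn z hz) (hAn w hwA)]
      split_ifs with h
      · rw [h]
      · simp
    rw [Finset.sum_congr rfl this, Finset.sum_ite_eq' A w, if_pos hwA]
  simp_rw [hsum, zero_mul, Finset.sum_const_zero] at key
  exact (mul_eq_zero.1 key.symm).resolve_left hnE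

/-- The vector over `F` whose transform is the indicator of a stable set `Q`: it is a nonzero code
vector, and it is in the Galois dual once `-p^k Q` consists of roots of the code. -/
theorem exists_ne_zero_mem_inter_galoisDualSet {F E : Type*} [Field F] [Fintype F] [Field E]
    [Algebra F E] {p k r n : ℕ} [Fact p.Prime] [CharP E p] [NeZero (r * n)] {θ : E}
    (hθ : orderOf θ = r * n) (hnE : (n : E) ≠ 0) {Q : Set (ZMod (r * n))}
    (hQ' : Q ⊆ oneCoset r n) (hQ : ∀ i ∈ Q, (Fintype.card F : ZMod (r * n)) * i ∈ Q)
    (hne : Q.Nonempty) (hneg : ∀ i ∈ Q, -((p ^ k : ℕ) * i) ∈ oneCoset r n \ Q) :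
    ∃ x ≠ 0, x ∈ codeOfDefSet F n θ (oneCoset r n \ Q) ∩
      galoisDualSet (p ^ k) (codeOfDefSet F n θ (oneCoset r n \ Q)) := by
  classical
  have hn : n ≠ 0 := by rintro rfl; simp at hnE
  have hΛ : θ ^ n ≠ 0 := pow_ne_zero _ <| by
    rintro rfl
    exact NeZero.ne (r * n) (by rw [← hθ]; simp)
  obtain ⟨A, hAmem, hAex, hAn, hAq⟩ := exists_finset_pow_val (F := F) hθ hQ' hQ
  choose a ha using exists_algebraMap_eq_sum_inv_pow (F := F) A hAq
  have htr : ∀ s ∈ oneCoset r n, ∑ j : Fin n, algebraMap F E (a j) * (θ ^ s.val) ^ (j : ℕ) =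
      if s ∈ Q then (n : E) else 0 := by
    intro s hs
    have h := sum_sum_inv_pow_mul_pow hΛ hn A hAn (pow_val_pow_of_mem_oneCoset hθ hs) 0
    simp only [zero_add, pow_zero, mul_one, hAmem] at h
    simp_rw [ha]
    exact h
  refine ⟨fun j => a j, ?_, ?_, ?_⟩
  · intro h0
    obtain ⟨s, hs⟩ := hne
    have h := htr s (hQ' hs)
    have h1 : ∀ j : Fin n, a j = 0 := fun j => congrFun h0 j
    simp only [h1, map_zero, zero_mul, Finset.sum_const_zero, if_pos hs] at h
    exact hnE h.symm
  · rw [mem_codeOfDefSet_iff]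
    intro s hs
    rw [htr s hs.1, if_neg hs.2]
  · intro c hc
    rw [mem_codeOfDefSet_iff] at hc
    apply (algebraMap F E).injective
    simp only [map_sum, map_mul, map_pow, ha, map_zero]
    simp_rw [sum_pow_char_pow, Finset.mul_sum]
    rw [Finset.sum_comm]
    refine Finset.sum_eq_zero fun z hz => ?_
    obtain ⟨i, hi, rfl⟩ := hAex z hz
    rw [← hc _ (hneg i hi)]
    refine Finset.sum_congr rfl fun j _ => ?_
    rw [pow_val_neg hθ, pow_val_natCast_mul hθ]
    simp only [inv_pow, ← pow_mul, mul_comm, mul_left_comm]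

/-- With `λ` of order `r`, `λ^{1+p^{e-k}} = 1`, `gcd(n,q)=1`: every
`λ`-constacyclic code `C_P` of length `n` over `F_q` (for every defining set
`P ⊆ 1 + rZ_{rn}` that is a union of `q`-cyclotomic cosets) is Galois LCD iff there is an
integer `j` with `p^{ej-k} ≡ -1 (mod rn)`. -/
theorem stmt11 {p e k r n : ℕ} (hp : p.Prime) (hk : k < e) (hr : 0 < r) (hn : 0 < n)
    {F : Type*} [Field F] [Fintype F] (hcard : Fintype.card F = p ^ e)
    (hcop : Nat.Coprime n (p ^ e)) (lam : F) (hlam : lam ≠ 0)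
    (hord : orderOf lam = r) (hlam1 : lam ^ (1 + p ^ (e - k)) = 1)
    {E : Type*} [Field E] [Algebra F E] (θ : E)
    (hθ : orderOf θ = r * n) (hθn : θ ^ n = algebraMap F E lam) :
    (∀ P : Set (ZMod (r * n)), P ⊆ oneCoset r n →
        (fun x : ZMod (r * n) => (p : ZMod (r * n)) ^ e * x) '' P = P →
        codeOfDefSet F n θ P ∩ galoisDualSet (p ^ k) (codeOfDefSet F n θ P) = {0}) ↔
      ∃ j : ℕ, k ≤ e * j ∧ (p : ZMod (r * n)) ^ (e * j - k) = -1 := by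
  have hpp := Fact.mk hp
  have hN : NeZero (r * n) := ⟨(Nat.mul_pos hr hn).ne'⟩
  have hF : CharP F p := charP_of_card_eq_prime_pow hcard
  have hE : CharP E p := charP_of_injective_algebraMap (algebraMap F E).injective p
  have hpn : Nat.Coprime p n :=
    ((Nat.coprime_pow_right_iff (by omega) n p).1 hcop).symm
  have hnE : (n : E) ≠ 0 := by
    rw [Ne, CharP.cast_eq_zero_iff E p n]
    exact (hp.coprime_iff_not_dvd).1 hpn
  have hq1 : 1 ≤ p ^ e := Nat.one_le_pow _ _ hp.pos
  have hrq : r ∣ p ^ e - 1 := by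
    rw [← hord, ← hcard]
    exact orderOf_dvd_of_pow_eq_one (FiniteField.pow_card_sub_one_eq_one lam hlam)
  have hqmod : p ^ e ≡ 1 [MOD r] := ((Nat.modEq_iff_dvd' hq1).2 hrq).symm
  have hpr : Nat.Coprime p r := by
    have h : Nat.Coprime (p ^ e) r := by
      rw [Nat.Coprime, hqmod.gcd_eq, Nat.gcd_one_left]
    exact (Nat.coprime_pow_left_iff (by omega) p r).1 h
  have hpu : IsUnit (p : ZMod (r * n)) :=
    (ZMod.isUnit_iff_coprime p (r * n)).2 (hpr.mul_right hpn)
  have hqC : ∀ i ∈ oneCoset r n, (p : ZMod (r * n)) ^ e * i ∈ oneCoset r n := by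
    intro i hi
    have h := natCast_mul_mem_oneCoset hqmod hi
    rwa [Nat.cast_pow] at h
  have hcast : (Fintype.card F : ZMod (r * n)) = (p : ZMod (r * n)) ^ e := by
    rw [hcard, Nat.cast_pow]
  have hCimg := image_mul_eq_of_subset (hpu.pow e) hqC
  constructor
  · intro H
    by_contra hno
    set Q : Set (ZMod (r * n)) := {s | ∃ m : ℕ, s = ((p : ZMod (r * n)) ^ e) ^ m} with hQdef
    have hQC : Q ⊆ oneCoset r n := by
      rintro s ⟨m, rfl⟩
      induction m with
      | zero => rw [mem_oneCoset_iff]; exact ⟨0, by simp⟩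
      | succ m ih => rw [pow_succ']; exact hqC _ ih
    have hQq : ∀ i ∈ Q, (p : ZMod (r * n)) ^ e * i ∈ Q := by
      rintro s ⟨m, rfl⟩
      exact ⟨m + 1, by rw [pow_succ']⟩
    have hrk : r ∣ 1 + p ^ k := by
      have h1 : r ∣ 1 + p ^ (e - k) := by
        rw [← hord]; exact orderOf_dvd_of_pow_eq_one hlam1
      have h2 : p ^ k * (1 + p ^ (e - k)) = (1 + p ^ k) + (p ^ e - 1) := by
        rw [mul_add, ← pow_add, Nat.add_sub_cancel' hk.le]; omega
      exact (Nat.dvd_add_left hrq).1 (h2 ▸ h1.mul_left (p ^ k))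
    obtain ⟨x, hx0, hx⟩ := exists_ne_zero_mem_inter_galoisDualSet (F := F) (p := p) (k := k)
      hθ hnE hQC (by rw [hcast]; exact hQq) ⟨1, 0, by simp⟩ (by
        rintro i hi
        refine ⟨neg_natCast_mul_mem_oneCoset hrk (hQC hi), ?_⟩
        rintro ⟨l, hl⟩
        obtain ⟨m, rfl⟩ := hi
        apply hno
        obtain ⟨φ, hφ0, hφ⟩ : ∃ φ : ℕ, 0 < φ ∧ ((p : ZMod (r * n)) ^ e) ^ φ = 1 := by
          obtain ⟨u, hu⟩ := hpu.pow e
          exact ⟨orderOf u, orderOf_pos u, by rw [← hu, ← Units.val_pow_eq_pow_val,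
            pow_orderOf_eq_one, Units.val_one]⟩
        have hφm : m + k ≤ φ * (m + k) := Nat.le_mul_of_pos_left _ hφ0
        set j := l + (φ * (m + k) - m) with hj
        have hkj : k ≤ e * j := by
          have h1 : k ≤ j := by omega
          exact h1.trans (Nat.le_mul_of_pos_left _ (by omega))
        refine ⟨j, hkj, ?_⟩
        apply ((hpu.pow k).mul ((hpu.pow e).pow m)).mul_right_cancel
        have h3 : (p : ZMod (r * n)) ^ (e * j - k) * (p ^ k * (p ^ e) ^ m) =
            ((p : ZMod (r * n)) ^ e) ^ l := by
          rw [← mul_assoc, ← pow_add, Nat.sub_add_cancel hkj, pow_mul, ← pow_add,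
            show j + m = l + φ * (m + k) by omega, pow_add, pow_mul _ φ, hφ, one_pow, mul_one]
        rw [h3, ← hl]
        push_cast
        ring)
    have h := H (oneCoset r n \ Q) Set.sdiff_subset (by
      rw [Set.image_sdiff (hpu.pow e).mul_right_injective, hCimg,
        image_mul_eq_of_subset (hpu.pow e) hQq])
    rw [h] at hx
    exact hx0 hx
  · rintro ⟨J, hkJ, hJ⟩ P hPC hPq
    apply Set.Subset.antisymm
    · rintro x ⟨hxC, hxD⟩
      rw [Set.mem_singleton_iff]
      rw [mem_codeOfDefSet_iff] at hxC
      apply eq_zero_of_forall_mem_oneCoset (E := E) hθ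
      intro b hb
      by_cases hbP : b ∈ P
      · exact hxC b hbP
      have hcompl : ∀ i ∈ oneCoset r n \ P,
          (Fintype.card F : ZMod (r * n)) * i ∈ oneCoset r n \ P := by
        rw [hcast]
        rintro i ⟨hi, hiP⟩
        refine ⟨hqC i hi, fun h => hiP ?_⟩
        rw [← hPq] at h
        obtain ⟨i', hi', h⟩ := h
        rwa [← (hpu.pow e).mul_right_injective h]
      have h := sum_mul_inv_pow_eq_zero_of_orthogonal (y := fun j => x j ^ p ^ k) hθ hnE hcompl
        hPC hxD ⟨hb, hbP⟩
      set u := e * J - k with hu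
      have h' := congrArg (fun z => z ^ p ^ u) h
      simp only [sum_pow_char_pow] at h'
      rw [zero_pow (pow_ne_zero _ hp.ne_zero)] at h'
      rw [← h']
      refine Finset.sum_congr rfl fun j _ => ?_
      have hinv : ((θ ^ b.val)⁻¹) ^ p ^ u = θ ^ b.val := by
        rw [← pow_val_neg hθ, ← pow_val_natCast_mul hθ, Nat.cast_pow, hJ, neg_mul_neg, one_mul]
      rw [mul_pow, ← map_pow, ← pow_mul (x j), ← pow_add, pow_right_comm (θ ^ b.val)⁻¹, hinv,
        show k + u = e * J by omega, pow_mul, ← hcard, FiniteField.pow_card_pow]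
    · rintro x rfl
      refine ⟨?_, ?_⟩
      · rw [mem_codeOfDefSet_iff]; simp
      · intro c _
        simp [hp.ne_zero]
end
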